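/- If f ≥ 0 is a random variable, then its quantization f̂ is a positive operator on H. -/

import Mathlib

open MeasureTheory ContinuousLinearMap

noncomputable section

variable {Ω : Type*} [MeasurableSpace Ω]

/-- `T` is the quantization `f̂` of the nonnegative random variable `f`:
the integral operator with kernel `min (f x) (f y)`. -/
def IsQuantization (ν : Measure Ω) (f : Ω → ℝ) (T : Lp ℂ 2 ν →L[ℂ] Lp ℂ 2 ν) : Prop :=
  ∀ g : Lp ℂ 2 ν,
    (T g : Ω → ℂ) =ᵐ[ν] fun y => ∫ x, ((min (f x) (f y) : ℝ) : ℂ) * (g : Ω → ℂ) x ∂ν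

open Filter Topology Set
open scoped ComplexOrder

/-- If almost all truncations at levels `f y` are measurable then `f` is. -/
theorem aemeas_of_trunc (μ : Measure Ω) (f : Ω → ℝ)
    (h : ∀ᵐ y ∂μ, AEMeasurable (fun x => min (f x) (f y)) μ) : AEMeasurable f μ := by
  have key : ∀ q : ℝ, NullMeasurableSet (f ⁻¹' Ioi q) μ := by
    intro q
    by_cases hc : ∃ y, AEMeasurable (fun x => min (f x) (f y)) μ ∧ q < f y
    · obtain ⟨y, hy, hq⟩ := hc
      have : f ⁻¹' Ioi q = (fun x => min (f x) (f y)) ⁻¹' Ioi q := by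
        ext x; simp [hq]
      rw [this]
      exact hy.nullMeasurableSet_preimage measurableSet_Ioi
    · push Not at hc
      apply NullMeasurableSet.of_null
      have h2 : ∀ᵐ y ∂μ, ¬ (q < f y) := by
        filter_upwards [h] with y hy
        exact not_lt.2 (hc y hy)
      rw [ae_iff] at h2
      simp only [not_not] at h2
      exact h2
  have hn : NullMeasurable f μ :=
    @measurable_of_Ioi ℝ (NullMeasurableSpace Ω μ) _ _ _ _ _ _ _ f key
  exact hn.aemeasurable

theorem quant_ind (ν : Measure Ω) [IsProbabilityMeasure ν] (f : Ω → ℝ)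
    (T : Lp ℂ 2 ν →L[ℂ] Lp ℂ 2 ν) (hT : IsQuantization ν f T) {A : Set Ω}
    (hA : MeasurableSet A) (c : ℂ) :
    (T (indicatorConstLp 2 hA (measure_ne_top ν A) c) : Ω → ℂ) =ᵐ[ν]
      fun y => ((∫ x in A, min (f x) (f y) ∂ν : ℝ) : ℂ) * c := by
  filter_upwards [hT (indicatorConstLp 2 hA (measure_ne_top ν A) c)] with y hy
  rw [hy, ← integral_complex_ofReal, ← integral_mul_const, ← integral_indicator hA]
  apply integral_congr_ae
  filter_upwards [indicatorConstLp_coeFn (p := 2) (hs := hA) (hμs := measure_ne_top ν A)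
    (c := c)] with x hx
  rw [hx]
  by_cases hxA : x ∈ A <;> simp [hxA]

theorem quant_zero (ν : Measure Ω) [IsProbabilityMeasure ν] (f : Ω → ℝ) (hf0 : ∀ x, 0 ≤ f x)
    (T : Lp ℂ 2 ν →L[ℂ] Lp ℂ 2 ν) (hT : IsQuantization ν f T)
    (hB : ∃ᵐ y ∂ν, ¬ AEMeasurable (fun x => min (f x) (f y)) ν) : T = 0 := by
  set r : Set Ω → Ω → ℝ := fun A y => ∫ x in A, min (f x) (f y) ∂ν with hr
  have r0 : ∀ A y, 0 ≤ r A y := fun A y =>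
    integral_nonneg (fun x => le_min (hf0 x) (hf0 y))
  have rB : ∀ y, ¬ AEMeasurable (fun x => min (f x) (f y)) ν → r univ y = 0 := by
    intro y hy
    simp only [hr, Measure.restrict_univ]
    exact integral_undef (fun h => hy h.1.aemeasurable)
  have hsum : ∀ A, MeasurableSet A → ∀ᵐ y ∂ν, r A y + r Aᶜ y = r univ y := by
    intro A hA
    have e : indicatorConstLp 2 hA (measure_ne_top ν A) (1:ℂ) +
        indicatorConstLp 2 hA.compl (measure_ne_top ν Aᶜ) (1:ℂ) =
        indicatorConstLp 2 MeasurableSet.univ (measure_ne_top ν univ) (1:ℂ) := by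
      apply Lp.ext
      filter_upwards [Lp.coeFn_add (indicatorConstLp 2 hA (measure_ne_top ν A) (1:ℂ))
        (indicatorConstLp 2 hA.compl (measure_ne_top ν Aᶜ) (1:ℂ)),
        indicatorConstLp_coeFn (p := 2) (hs := hA) (hμs := measure_ne_top ν A) (c := (1:ℂ)),
        indicatorConstLp_coeFn (p := 2) (hs := hA.compl) (hμs := measure_ne_top ν Aᶜ)
          (c := (1:ℂ)),
        indicatorConstLp_coeFn (p := 2) (hs := MeasurableSet.univ)
          (hμs := measure_ne_top ν univ) (c := (1:ℂ))] with x h1 h2 h3 h4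
      rw [h1, Pi.add_apply, h2, h3, h4]
      by_cases hxA : x ∈ A <;> simp [hxA]
    have e2 := congrArg T e
    rw [map_add] at e2
    have e3 := Lp.coeFn_add (T (indicatorConstLp 2 hA (measure_ne_top ν A) (1:ℂ)))
      (T (indicatorConstLp 2 hA.compl (measure_ne_top ν Aᶜ) (1:ℂ)))
    rw [e2] at e3
    filter_upwards [e3, quant_ind ν f T hT hA 1, quant_ind ν f T hT hA.compl 1,
      quant_ind ν f T hT MeasurableSet.univ 1] with y h1 h2 h3 h4
    rw [Pi.add_apply, h2, h3, h4] at h1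
    simp only [mul_one] at h1
    exact_mod_cast h1.symm
  set u := T (indicatorConstLp 2 MeasurableSet.univ (measure_ne_top ν univ) (1:ℂ)) with hu
  have hur : ∀ᵐ y ∂ν, u y = r univ y := by
    filter_upwards [quant_ind ν f T hT MeasurableSet.univ 1] with y hy
    rw [hu, hy, mul_one]
  set A : Set Ω := {y | u y ≠ 0} with hAdef
  have hA : MeasurableSet A :=
    ((Lp.stronglyMeasurable u).measurable (measurableSet_singleton (0:ℂ))).compl
  have hAS : ∀ᵐ y ∂(ν.restrict A), AEMeasurable (fun x => min (f x) (f y)) ν := by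
    rw [ae_restrict_iff' hA]
    filter_upwards [hur] with y hy hyA
    by_contra hcon
    apply hyA
    rw [hy, rB y hcon]; simp
  have hfA : AEMeasurable f (ν.restrict A) :=
    aemeas_of_trunc _ f (hAS.mono fun y hy => hy.restrict)
  obtain ⟨y', hy', hs'⟩ := (hB.and_eventually (hsum A hA)).exists
  have hrA : r A y' = 0 := by
    have := r0 A y'
    have := r0 Aᶜ y'
    have := rB y' hy'
    linarith
  have hlt : ∀ᵐ x ∂(ν.restrict A), f x ≤ f y' := by
    filter_upwards [hAS] with x hx
    by_contra hcon
    push Not at hcon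
    apply hy'
    have : (fun z => min (f z) (f y')) = fun z => min (min (f z) (f x)) (f y') := by
      ext z; rw [min_assoc, min_eq_right hcon.le]
    rw [this]
    exact hx.min aemeasurable_const
  have hint : Integrable f (ν.restrict A) := by
    refine Integrable.of_bound hfA.aestronglyMeasurable (f y') ?_
    filter_upwards [hlt] with x hx
    rwa [Real.norm_of_nonneg (hf0 x)]
  have hf00 : f =ᵐ[ν.restrict A] 0 := by
    rw [← integral_eq_zero_iff_of_nonneg hf0 hint, ← hrA]
    apply integral_congr_ae
    filter_upwards [hlt] with x hx
    rw [min_eq_left hx]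
  have hAnull : ∀ᵐ y ∂ν, y ∉ A := by
    have := (ae_restrict_iff' hA).1 hf00
    filter_upwards [this, hur] with y hy hy2 hyA
    apply hyA
    rw [hy2]
    have : f y = 0 := hy hyA
    simp only [hr, this]
    simp [fun x => min_eq_right (hf0 x)]
  have hz : ∀ A, MeasurableSet A → ∀ᵐ y ∂ν, r A y = 0 := by
    intro C hC
    filter_upwards [hAnull, hur, hsum C hC] with y h1 h2 h3
    have h4 : u y = 0 := by
      by_contra h; exact h1 h
    have : r univ y = 0 := by
      rw [h4] at h2; exact_mod_cast h2.symm
    have := r0 C y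
    have := r0 Cᶜ y
    linarith
  ext1 g
  refine Lp.induction (p := 2) (by norm_num) (fun g => T g = (0 : Lp ℂ 2 ν →L[ℂ] Lp ℂ 2 ν) g)
    ?_ ?_ ?_ g
  · intro c s hs hμs
    rw [Lp.simpleFunc.coe_indicatorConst]
    apply Lp.ext
    filter_upwards [quant_ind ν f T hT hs c, hz s hs, Lp.coeFn_zero ℂ 2 ν] with y h1 h2 h3
    rw [h1]
    simp only [hr] at h2
    rw [h2, _root_.zero_apply, h3]
    simp
  · intro f g hf hg _ h1 h2
    rw [map_add, h1, h2, map_add]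
  · exact isClosed_eq T.continuous (ContinuousLinearMap.continuous _)

/-- The quadratic form, for `f` bounded on the support of `g`. -/
theorem quad_form (ν : Measure Ω) [IsProbabilityMeasure ν] (f : Ω → ℝ) (hf : Measurable f)
    (hf0 : ∀ x, 0 ≤ f x) (N : ℝ) (g : Ω → ℂ) (hg : Integrable g ν)
    (hgm : Measurable g) (hgN : ∀ x, N < f x → g x = 0) :
    0 ≤ ∫ y, g y * (starRingEnd ℂ) (∫ x, ((min (f x) (f y) : ℝ) : ℂ) * g x ∂ν) ∂ν := by
  set μ : Measure ℝ := volume.restrict (Ioc 0 N) with hμ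
  set k : ℝ → Ω → ℂ := fun t x => if t < f x then 1 else 0 with hk
  have kmeas : Measurable (fun p : Ω × ℝ => k p.2 p.1) :=
    Measurable.ite (measurableSet_lt measurable_snd (hf.comp measurable_fst))
      measurable_const measurable_const
  have knorm : ∀ t x, ‖k t x‖ ≤ 1 := by
    intro t x; simp only [hk]; split_ifs <;> simp
  have kmeas1 : ∀ x, Measurable (fun t => k t x) := fun x =>
    kmeas.comp (measurable_const.prodMk measurable_id)
  have kmeas2 : ∀ t, Measurable (fun x => k t x) := fun t =>
    kmeas.comp (measurable_id.prodMk measurable_const)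
  set G : ℝ → ℂ := fun t => ∫ x, k t x * g x ∂ν with hG
  have hgprod : Integrable (fun p : Ω × ℝ => g p.1) (ν.prod μ) := hg.comp_fst μ
  have layer : ∀ x y, f x ≤ N → f y ≤ N →
      ((min (f x) (f y) : ℝ) : ℂ) = ∫ t, k t y * k t x ∂μ := by
    intro x y hx hy
    have : (fun t => k t y * k t x) = (Iio (min (f x) (f y))).indicator (fun _ => (1:ℂ)) := by
      ext t
      simp only [hk, indicator, mem_Iio, lt_min_iff]
      split_ifs <;> simp_all
    rw [this, integral_indicator measurableSet_Iio, hμ,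
      Measure.restrict_restrict measurableSet_Iio]
    have h2 : Iio (min (f x) (f y)) ∩ Ioc 0 N = Ioo 0 (min (f x) (f y)) := by
      ext t; simp only [mem_inter_iff, mem_Iio, mem_Ioc, mem_Ioo]
      constructor
      · rintro ⟨h1, h2, h3⟩; exact ⟨h2, h1⟩
      · rintro ⟨h1, h2⟩
        exact ⟨h2, h1, (h2.le.trans (min_le_left _ _)).trans hx⟩
    rw [h2]
    rw [integral_const, measureReal_restrict_apply_univ, Real.volume_real_Ioo_of_le (le_min (hf0 x) (hf0 y))]
    simp
  have Gbound : ∀ t, ‖G t‖ ≤ ∫ x, ‖g x‖ ∂ν := by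
    intro t
    refine norm_integral_le_of_norm_le hg.norm (ae_of_all _ fun x => ?_)
    rw [norm_mul]
    exact mul_le_of_le_one_left (norm_nonneg _) (knorm t x)
  have Gmeas : StronglyMeasurable G := by
    have : Measurable (fun p : ℝ × Ω => k p.1 p.2 * g p.2) :=
      (kmeas.comp measurable_swap).mul (hgm.comp measurable_snd)
    exact this.stronglyMeasurable.integral_prod_right
  have inner : ∀ y, f y ≤ N →
      ∫ x, ((min (f x) (f y) : ℝ) : ℂ) * g x ∂ν = ∫ t, k t y * G t ∂μ := by
    intro y hy
    have e1 : ∀ x, ((min (f x) (f y) : ℝ) : ℂ) * g x = ∫ t, k t y * (k t x * g x) ∂μ := by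
      intro x
      by_cases hx : f x ≤ N
      · rw [layer x y hx hy, ← integral_mul_const]
        simp only [mul_assoc]
      · simp [hgN x (not_le.1 hx)]
    simp_rw [e1]
    rw [integral_integral_swap]
    · simp_rw [integral_const_mul, hG]
    · refine hgprod.mono ?_ (ae_of_all _ fun p => ?_)
      · exact (((kmeas1 y).comp measurable_snd).mul
          (kmeas.mul (hgm.comp measurable_fst))).aestronglyMeasurable
      · simp only [Function.uncurry, norm_mul]
        have := knorm p.2 y
        have := knorm p.2 p.1
        calc _ ≤ 1 * (1 * ‖g p.1‖) := by gcongr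
          _ = _ := by simp
  have e2 : ∀ y, g y * (starRingEnd ℂ) (∫ x, ((min (f x) (f y) : ℝ) : ℂ) * g x ∂ν) =
      ∫ t, (starRingEnd ℂ) (G t) * (k t y * g y) ∂μ := by
    intro y
    by_cases hy : f y ≤ N
    · rw [inner y hy, ← integral_conj, ← integral_const_mul]
      congr 1; ext t
      have : (starRingEnd ℂ) (k t y) = k t y := by
        simp only [hk]; split_ifs <;> simp
      rw [map_mul, this]; ring
    · simp [hgN y (not_le.1 hy)]
  simp_rw [e2]
  rw [integral_integral_swap]
  · simp_rw [integral_const_mul]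
    have : ∀ t, (starRingEnd ℂ) (G t) * ∫ y, k t y * g y ∂ν = ((‖G t‖ ^ 2 : ℝ) : ℂ) := by
      intro t
      rw [mul_comm]
      change G t * _ = _
      rw [Complex.mul_conj, Complex.normSq_eq_norm_sq]
    simp_rw [this]
    rw [integral_complex_ofReal]
    exact_mod_cast integral_nonneg (fun t => by positivity)
  · refine (hgprod.norm.const_mul (∫ x, ‖g x‖ ∂ν)).mono ?_ (ae_of_all _ fun p => ?_)
    · exact (((Complex.continuous_conj.measurable.comp
        (Gmeas.measurable.comp measurable_snd))).mul
          (kmeas.mul (hgm.comp measurable_fst))).aestronglyMeasurable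
    · simp only [Function.uncurry, norm_mul, RCLike.norm_conj, norm_norm]
      have := knorm p.2 p.1
      have := Gbound p.2
      have h3 : 0 ≤ ∫ x, ‖g x‖ ∂ν := integral_nonneg fun _ => norm_nonneg _
      rw [Real.norm_of_nonneg h3]
      calc _ ≤ (∫ x, ‖g x‖ ∂ν) * (1 * ‖g p.1‖) := by gcongr
        _ = _ := by simp

theorem quant_pos (ν : Measure Ω) [IsProbabilityMeasure ν] (f : Ω → ℝ) (hf : Measurable f)
    (hf0 : ∀ x, 0 ≤ f x)
    (T : Lp ℂ 2 ν →L[ℂ] Lp ℂ 2 ν) (hT : IsQuantization ν f T) : T.IsPositive := by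
  have main : ∀ g : Lp ℂ 2 ν, 0 ≤ inner ℂ (T g) g := by
    intro g
    set s : ℕ → Set Ω := fun n => {x | f x ≤ n} with hs
    have hsm : ∀ n, MeasurableSet (s n) := fun n => measurableSet_le hf measurable_const
    have hgL := Lp.memLp g
    have hgm : Measurable (g : Ω → ℂ) := (Lp.stronglyMeasurable g).measurable
    have hL : ∀ n, MemLp ((s n).indicator g) 2 ν := fun n => hgL.indicator (hsm n)
    have hlim : Tendsto (fun n => (hL n).toLp _) atTop (𝓝 g) := by
      have : Tendsto (fun n => (hL n).toLp _) atTop (𝓝 (hgL.toLp g)) := by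
        rw [Lp.tendsto_Lp_iff_tendsto_eLpNorm'']
        refine tendsto_Lp_finite_of_tendsto_ae (by norm_num) (by norm_num)
          (fun n => (hL n).1) hgL ?_ ?_
        · intro ε hε
          obtain ⟨δ, hδ, h⟩ := unifIntegrable_const (ι := ℕ) (μ := ν) (p := 2) (by norm_num)
            (by norm_num) hgL hε
          refine ⟨δ, hδ, fun i t ht hνt => le_trans ?_ (h i t ht hνt)⟩
          rw [indicator_indicator, inter_comm, ← indicator_indicator]
          exact eLpNorm_indicator_le _
        · refine ae_of_all _ fun x => ?_
          apply tendsto_const_nhds.congr'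
          obtain ⟨n, hn⟩ := exists_nat_ge (f x)
          filter_upwards [eventually_ge_atTop n] with m hm
          rw [indicator_of_mem]
          exact hn.trans (by exact_mod_cast hm)
      simpa using this
    have hlim2 : Tendsto (fun n => inner ℂ (T ((hL n).toLp _)) ((hL n).toLp _)) atTop
        (𝓝 (inner ℂ (T g) g)) :=
      ((T.continuous.tendsto g).comp hlim).inner hlim
    refine ge_of_tendsto' hlim2 fun n => ?_
    have hq := quad_form ν f hf hf0 n ((s n).indicator g) ((hL n).integrable (by norm_num))
      (hgm.indicator (hsm n)) (fun x hx => indicator_of_notMem (by simpa [hs] using hx) _)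
    rw [L2.inner_def]
    refine hq.trans_eq (integral_congr_ae ?_)
    filter_upwards [hT ((hL n).toLp _), (hL n).coeFn_toLp] with y h1 h2
    rw [RCLike.inner_apply, h1, h2]
    congr 2
    apply integral_congr_ae
    filter_upwards [(hL n).coeFn_toLp] with x hx
    rw [hx]
  rw [ContinuousLinearMap.isPositive_iff_complex]
  intro g
  have h := main g
  rw [Complex.le_def] at h
  refine ⟨?_, h.1⟩
  apply Complex.ext
  · simp
  · simpa using h.2

theorem stmt12 (ν : Measure Ω) [IsProbabilityMeasure ν] (f : Ω → ℝ) (hf0 : ∀ x, 0 ≤ f x)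
    (T : Lp ℂ 2 ν →L[ℂ] Lp ℂ 2 ν) (hT : IsQuantization ν f T) :
    T.IsPositive := by
  by_cases h : ∀ᵐ y ∂ν, AEMeasurable (fun x => min (f x) (f y)) ν
  · have hm := aemeas_of_trunc ν f h
    have hae : f =ᵐ[ν] fun x => max (hm.mk f x) 0 := by
      filter_upwards [hm.ae_eq_mk] with x hx
      rw [← hx, max_eq_left (hf0 x)]
    refine quant_pos ν (fun x => max (hm.mk f x) 0) (hm.measurable_mk.max measurable_const)
      (fun x => le_max_right _ _) T ?_
    intro g
    filter_upwards [hT g, hae] with y hy hy2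
    rw [hy]
    apply integral_congr_ae
    filter_upwards [hae] with x hx
    rw [hx, hy2]
  · rw [quant_zero ν f hf0 T hT (not_eventually.1 h)]
    exact ContinuousLinearMap.isPositive_zero
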